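/- Let ε ∈ (0,1] and let F be a unit-norm sequence in C^M with N vectors satisfying ‖FF* − (N/M)I‖_HS ≤ N/(2M). If F is not ε-orthogonally partitionable, then ∑_{n=1}^N ‖P_n FF* f_n‖² ≥ (ε²/(4M⁴))·‖FF* − (N/M)I‖_HS². -/

import Mathlib

noncomputable section
open scoped InnerProductSpace
open Finset

def col {M N : ℕ} (F : Matrix (Fin M) (Fin N) ℂ) (n : Fin N) : EuclideanSpace ℂ (Fin M) :=
  (WithLp.equiv 2 (Fin M → ℂ)).symm (fun m => F m n)

def hsq {M N : ℕ} (A : Matrix (Fin M) (Fin N) ℂ) : ℝ := ∑ i, ∑ j, ‖A i j‖ ^ 2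

def frameOp {M N : ℕ} (F : Matrix (Fin M) (Fin N) ℂ) (x : EuclideanSpace ℂ (Fin M)) :
    EuclideanSpace ℂ (Fin M) :=
  (WithLp.equiv 2 (Fin M → ℂ)).symm ((F * F.conjTranspose).mulVec x)

/-- `F` is `ε`-orthogonally partitionable. -/
def epsOP {M N : ℕ} (F : Matrix (Fin M) (Fin N) ℂ) (ε : ℝ) : Prop :=
  ∃ I : Finset (Fin N), I ≠ ∅ ∧ I ≠ univ ∧
    ∀ i ∈ I, ∀ j ∉ I, ‖⟪col F i, col F j⟫_ℂ‖ < ε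

/-- A real family with zero sum has a gap in its range, at least `card⁻³ᐟ²` times its `ℓ²` norm. -/
theorem exists_gap_of_sum_eq_zero {ι : Type*} [Fintype ι] (x : ι → ℝ) (hsum : ∑ i, x i = 0)
    (hpos : 0 < ∑ i, x i ^ 2) :
    ∃ a b : ℝ, a < b ∧ ∑ i, x i ^ 2 ≤ (Fintype.card ι : ℝ) ^ 3 * (b - a) ^ 2 ∧
      (∀ i, x i ≤ a ∨ b ≤ x i) ∧ (∃ i, x i ≤ a) ∧ ∃ i, b ≤ x i := by
  classical
  have hne : Nonempty ι := by
    by_contra h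
    rw [not_nonempty_iff] at h
    simp at hpos
  obtain ⟨l, hl⟩ := Finite.exists_min x
  obtain ⟨u, hu⟩ := Finite.exists_max x
  set m : ℕ := Fintype.card ι with hm
  have hm0 : (0 : ℝ) < m := by exact_mod_cast Fintype.card_pos
  have hl0 : x l ≤ 0 := by
    by_contra! h
    have := Finset.sum_pos (fun i _ => h.trans_le (hl i)) (univ_nonempty (α := ι))
    linarith
  have hu0 : 0 ≤ x u := by
    by_contra! h
    have := Finset.sum_neg (fun i _ => (hu i).trans_lt h) (univ_nonempty (α := ι))
    linarith
  have hle : ∑ i, x i ^ 2 ≤ m * (x u - x l) ^ 2 := by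
    calc ∑ i, x i ^ 2 ≤ ∑ _i : ι, (x u - x l) ^ 2 := by
          refine Finset.sum_le_sum fun i _ => sq_le_sq' ?_ ?_
          · linarith [hl i]
          · linarith [hu i]
      _ = _ := by simp [hm]
  have hR : 0 < x u - x l := by
    refine lt_of_le_of_ne (by linarith) fun h => ?_
    rw [← h] at hle
    simp at hle
    linarith
  set δ : ℝ := (x u - x l) / m with hδ
  have hδ0 : 0 < δ := div_pos hR hm0
  have hmδ : x u - x l = m * δ := by rw [hδ]; field_simp
  let h : ι → ℤ := fun i => ⌈(x i - x l) / δ⌉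
  obtain ⟨k, hk, hkn⟩ : ∃ k ∈ Finset.Icc (1 : ℤ) m, k ∉ (univ.erase l).image h := by
    apply Finset.exists_mem_notMem_of_card_lt_card
    calc #((univ.erase l).image h) ≤ #(univ.erase l) := card_image_le
      _ < #(univ : Finset ι) := card_erase_lt_of_mem (mem_univ l)
      _ = #(Finset.Icc (1 : ℤ) m) := by simp [hm]
  have hk' : ∀ i, h i ≠ k := by
    intro i hi
    by_cases hil : i = l
    · subst hil
      simp [h] at hi
      simp [← hi] at hk
    · exact hkn (mem_image.2 ⟨i, by simp [hil], hi⟩)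
  rw [Finset.mem_Icc] at hk
  have key : ∀ i, (h i < k → x i ≤ x l + (k - 1) * δ) ∧ (k < h i → x l + k * δ ≤ x i) := by
    intro i
    constructor
    · intro hi
      have h1 : h i ≤ k - 1 := by omega
      have h2 := Int.ceil_le.1 h1
      rw [div_le_iff₀ hδ0] at h2
      push_cast at h2
      linarith
    · intro hi
      have h2 := Int.lt_ceil.1 hi
      rw [lt_div_iff₀ hδ0] at h2
      linarith
  refine ⟨x l + (k - 1) * δ, x l + k * δ, by linarith, ?_, ?_, ⟨l, ?_⟩, ⟨u, ?_⟩⟩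
  · calc ∑ i, x i ^ 2 ≤ m * (x u - x l) ^ 2 := hle
      _ = _ := by rw [hmδ]; ring
  · intro i
    rcases lt_or_gt_of_ne (hk' i) with hi | hi
    · exact Or.inl ((key i).1 hi)
    · exact Or.inr ((key i).2 hi)
  · apply (key l).1
    have : h l = 0 := by simp [h]
    omega
  · apply (key u).2
    have : h u = m := by
      simp only [h, hmδ, mul_div_assoc, div_self hδ0.ne', mul_one]
      simp
    have := hk' u
    omega

/-- The second moment about any point of a distribution that avoids the interval `(a, b)`. -/
theorem gap_sq_mul_le_sum_mul_sq {ι : Type*} [Fintype ι] (p x : ι → ℝ) (hp : ∀ i, 0 ≤ p i)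
    (hp1 : ∑ i, p i = 1) {a b : ℝ} (hab : a < b) (hx : ∀ i, x i ≤ a ∨ b ≤ x i) (μ : ℝ) :
    (b - a) ^ 2 * ((∑ i with b ≤ x i, p i) * (1 - ∑ i with b ≤ x i, p i))
      ≤ ∑ i, p i * (x i - μ) ^ 2 := by
  have hsplit := Finset.sum_filter_add_sum_filter_not univ (fun i => b ≤ x i) p
  rw [hp1] at hsplit
  rw [← Finset.sum_filter_add_sum_filter_not univ (fun i => b ≤ x i) (fun i => p i * (x i - μ) ^ 2)]
  set q := ∑ i with b ≤ x i, p i with hq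
  set r := ∑ i with ¬ b ≤ x i, p i with hr
  have hq0 : 0 ≤ q := Finset.sum_nonneg fun i _ => hp i
  have hr0 : 0 ≤ r := Finset.sum_nonneg fun i _ => hp i
  have hup : q * (max (b - μ) 0) ^ 2 ≤ ∑ i with b ≤ x i, p i * (x i - μ) ^ 2 := by
    rw [hq, Finset.sum_mul]
    refine Finset.sum_le_sum fun i hi => mul_le_mul_of_nonneg_left ?_ (hp i)
    have hi' := (mem_filter.1 hi).2
    rcases le_total (b - μ) 0 with h | h
    · rw [max_eq_right h, zero_pow two_ne_zero]
      positivity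
    · rw [max_eq_left h]
      exact pow_le_pow_left₀ h (by linarith) 2
  have hdown : r * (max (μ - a) 0) ^ 2 ≤ ∑ i with ¬ b ≤ x i, p i * (x i - μ) ^ 2 := by
    rw [hr, Finset.sum_mul]
    refine Finset.sum_le_sum fun i hi => mul_le_mul_of_nonneg_left ?_ (hp i)
    have hi' := (hx i).resolve_right (mem_filter.1 hi).2
    rcases le_total (μ - a) 0 with h | h
    · rw [max_eq_right h, zero_pow two_ne_zero]
      positivity
    · rw [max_eq_left h, ← neg_sub μ (x i), neg_sq]
      exact pow_le_pow_left₀ h (by linarith) 2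
  refine le_trans ?_ (add_le_add hup hdown)
  have hr1 : r = 1 - q := by linarith
  have hqr : ∀ s t : ℝ, 0 ≤ s → 0 ≤ t → b - a ≤ s + t →
      (b - a) ^ 2 * (q * r) ≤ q * s ^ 2 + r * t ^ 2 := by
    intro s t hs ht hst
    have h1 : (b - a) ^ 2 ≤ (s + t) ^ 2 := pow_le_pow_left₀ (by linarith) hst 2
    have h2 := mul_le_mul_of_nonneg_right h1 (mul_nonneg hq0 hr0)
    have h3 : q * s ^ 2 + r * t ^ 2 - (s + t) ^ 2 * (q * r) = (q * s - r * t) ^ 2 := by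
      rw [hr1]; ring
    nlinarith [sq_nonneg (q * s - r * t)]
  rw [← hr1]
  exact hqr _ _ (le_max_right _ _) (le_max_right _ _)
    (by linarith [le_max_left (b - μ) 0, le_max_left (μ - a) 0])

theorem norm_inner_le_sqrt_add_sqrt {ι E : Type*} [Fintype ι] [NormedAddCommGroup E]
    [InnerProductSpace ℂ E] (e : OrthonormalBasis ι ℂ E) (P : ι → Prop) [DecidablePred P]
    (f g : E) (hf : ‖f‖ = 1) (hg : ‖g‖ = 1) :
    ‖⟪f, g⟫_ℂ‖ ≤ √(1 - ∑ i with P i, ‖⟪e i, f⟫_ℂ‖ ^ 2) + √(∑ i with P i, ‖⟪e i, g⟫_ℂ‖ ^ 2) := by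
  have hsplit (v : E) (hv : ‖v‖ = 1) :
      ∑ i with P i, ‖⟪e i, v⟫_ℂ‖ ^ 2 + ∑ i with ¬ P i, ‖⟪e i, v⟫_ℂ‖ ^ 2 = 1 := by
    rw [Finset.sum_filter_add_sum_filter_not, e.sum_sq_norm_inner_right, hv, one_pow]
  have hle : ‖⟪f, g⟫_ℂ‖ ≤ ∑ i, ‖⟪e i, f⟫_ℂ‖ * ‖⟪e i, g⟫_ℂ‖ := by
    rw [← e.sum_inner_mul_inner f g]
    refine (norm_sum_le _ _).trans_eq (Finset.sum_congr rfl fun i _ => ?_)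
    rw [norm_mul, norm_inner_symm]
  rw [← Finset.sum_filter_add_sum_filter_not univ P] at hle
  have h1 := Real.sum_mul_le_sqrt_mul_sqrt (univ.filter P)
    (fun i => ‖⟪e i, f⟫_ℂ‖) (fun i => ‖⟪e i, g⟫_ℂ‖)
  have h2 := Real.sum_mul_le_sqrt_mul_sqrt (univ.filter fun i => ¬ P i)
    (fun i => ‖⟪e i, f⟫_ℂ‖) (fun i => ‖⟪e i, g⟫_ℂ‖)
  have hf0 : 0 ≤ ∑ i with ¬ P i, ‖⟪e i, f⟫_ℂ‖ ^ 2 := by positivity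
  have hg0 : 0 ≤ ∑ i with ¬ P i, ‖⟪e i, g⟫_ℂ‖ ^ 2 := by positivity
  have hg0' : 0 ≤ ∑ i with P i, ‖⟪e i, g⟫_ℂ‖ ^ 2 := by positivity
  have h3 : √(∑ i with P i, ‖⟪e i, f⟫_ℂ‖ ^ 2) ≤ 1 :=
    Real.sqrt_le_one.2 (by linarith [hsplit f hf])
  have h4 : √(∑ i with ¬ P i, ‖⟪e i, g⟫_ℂ‖ ^ 2) ≤ 1 :=
    Real.sqrt_le_one.2 (by linarith [hsplit g hg])
  rw [show 1 - ∑ i with P i, ‖⟪e i, f⟫_ℂ‖ ^ 2 = ∑ i with ¬ P i, ‖⟪e i, f⟫_ℂ‖ ^ 2 by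
    linarith [hsplit f hf]]
  have h5 := mul_le_of_le_one_left (Real.sqrt_nonneg (∑ i with P i, ‖⟪e i, g⟫_ℂ‖ ^ 2)) h3
  have h6 := mul_le_of_le_one_right (Real.sqrt_nonneg (∑ i with ¬ P i, ‖⟪e i, f⟫_ℂ‖ ^ 2)) h4
  linarith

theorem frameOp_eq_sum {M N : ℕ} (F : Matrix (Fin M) (Fin N) ℂ) (x : EuclideanSpace ℂ (Fin M)) :
    frameOp F x = ∑ n, ⟪col F n, x⟫_ℂ • col F n := by
  ext m
  have h : frameOp F x m = (F.mulVec (F.conjTranspose.mulVec x)) m := by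
    simp [frameOp, Matrix.mulVec_mulVec]
  rw [h]
  simp [Matrix.mulVec, dotProduct, col, PiLp.inner_apply, mul_comm]

theorem inner_frameOp {M N : ℕ} (F : Matrix (Fin M) (Fin N) ℂ) (x y : EuclideanSpace ℂ (Fin M)) :
    ⟪y, frameOp F x⟫_ℂ = ∑ n, ⟪col F n, x⟫_ℂ * ⟪y, col F n⟫_ℂ := by
  simp [frameOp_eq_sum]

theorem inner_frameOp_right {M N : ℕ} (F : Matrix (Fin M) (Fin N) ℂ)
    (x y : EuclideanSpace ℂ (Fin M)) : ⟪y, frameOp F x⟫_ℂ = ⟪frameOp F y, x⟫_ℂ := by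
  rw [← inner_conj_symm (frameOp F y) x, inner_frameOp, inner_frameOp]
  simp [mul_comm]

theorem hsq_eq_sum_eigenvalues_sq {M : ℕ} (A : Matrix (Fin M) (Fin M) ℂ) (hA : A.IsHermitian) :
    hsq A = ∑ i, hA.eigenvalues i ^ 2 := by
  have h1 (i : Fin M) : ∑ k, ‖(A.mulVec (hA.eigenvectorBasis i)) k‖ ^ 2 = hA.eigenvalues i ^ 2 := by
    rw [hA.mulVec_eigenvectorBasis]
    have h := hA.eigenvectorBasis.norm_eq_one i
    rw [EuclideanSpace.norm_eq, Real.sqrt_eq_one] at h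
    simp [mul_pow, ← Finset.mul_sum, h]
  have h2 (k : Fin M) : ∑ i, ‖(A.mulVec (hA.eigenvectorBasis i)) k‖ ^ 2 = ∑ j, ‖A k j‖ ^ 2 := by
    have h := hA.eigenvectorBasis.sum_sq_norm_inner_left (WithLp.toLp 2 fun j => star (A k j))
    rw [EuclideanSpace.norm_sq_eq] at h
    simpa [PiLp.inner_apply, Matrix.mulVec, dotProduct, mul_comm] using h
  simp_rw [hsq, ← h1, ← h2]
  exact Finset.sum_comm

theorem sq_div_four_mul_le_sum_of_not_epsOP {M N : ℕ} (hM : 0 < M) (hN : 0 < N) {ε : ℝ}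
    (hε0 : 0 < ε) (hε1 : ε ≤ 1) {F : Matrix (Fin M) (Fin N) ℂ} (hnop : ¬ epsOP F ε)
    (q : Fin N → ℝ) (hq0 : ∀ n, 0 ≤ q n) (hq1 : ∀ n, q n ≤ 1)
    (hF : ∀ i j, ‖⟪col F i, col F j⟫_ℂ‖ ≤ √(1 - q i) + √(q j))
    (hlow : (N : ℝ) / (2 * M) ≤ ∑ n, q n) (hhigh : (N : ℝ) / (2 * M) ≤ ∑ n, (1 - q n)) :
    ε ^ 2 / (4 * M) ≤ ∑ n, q n * (1 - q n) := by
  have hM1 : (1 : ℝ) ≤ M := by exact_mod_cast hM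
  have hN1 : (1 : ℝ) ≤ N := by exact_mod_cast hN
  have hε2 : ε ^ 2 ≤ 1 := pow_le_one₀ hε0.le hε1
  have hbase : ε ^ 2 / (4 * M) ≤ 1 / 2 * (N / (2 * M)) := by
    rw [show (1 : ℝ) / 2 * (N / (2 * M)) = N / (4 * M) by ring]
    gcongr
    linarith
  by_cases hI : (univ.filter fun n => 1 / 2 ≤ q n) = ∅
  · refine hbase.trans ?_
    refine (mul_le_mul_of_nonneg_left hlow (by norm_num)).trans ?_
    rw [Finset.mul_sum]
    refine Finset.sum_le_sum fun n _ => ?_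
    have : ¬ 1 / 2 ≤ q n := by simpa using (Finset.filter_eq_empty_iff.1 hI) (mem_univ n)
    nlinarith [hq0 n]
  by_cases hJ : (univ.filter fun n => 1 / 2 ≤ q n) = univ
  · refine hbase.trans ?_
    refine (mul_le_mul_of_nonneg_left hhigh (by norm_num)).trans ?_
    rw [Finset.mul_sum]
    refine Finset.sum_le_sum fun n _ => ?_
    have : 1 / 2 ≤ q n := (Finset.filter_eq_self.1 hJ) n (mem_univ n)
    nlinarith [hq1 n]
  obtain ⟨i, hi, j, hj, hij⟩ : ∃ i, 1 / 2 ≤ q i ∧ ∃ j, q j < 1 / 2 ∧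
      ε ≤ ‖⟪col F i, col F j⟫_ℂ‖ := by
    by_contra! h
    refine hnop ⟨_, hI, hJ, fun i hi j hj => ?_⟩
    simp only [mem_filter, mem_univ, true_and, not_le] at hi hj
    exact h i hi j hj
  have hne : i ≠ j := by
    rintro rfl
    linarith
  have hsum : q i * (1 - q i) + q j * (1 - q j) ≤ ∑ n, q n * (1 - q n) := by
    rw [← Finset.sum_pair (f := fun n => q n * (1 - q n)) hne]
    exact Finset.sum_le_sum_of_subset_of_nonneg (subset_univ _)
      fun n _ _ => mul_nonneg (hq0 n) (by linarith [hq1 n])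
  have h1 := Real.sq_sqrt (show 0 ≤ 1 - q i by linarith [hq1 i])
  have h2 := Real.sq_sqrt (hq0 j)
  have h3 : ε ^ 2 ≤ (√(1 - q i) + √(q j)) ^ 2 := pow_le_pow_left₀ hε0.le (hij.trans (hF i j)) 2
  have h4 : ε ^ 2 / 4 ≤ q i * (1 - q i) + q j * (1 - q j) := by
    nlinarith [sq_nonneg (√(1 - q i) - √(q j)), hq0 j, hq1 i]
  refine le_trans ?_ (h4.trans hsum)
  gcongr
  linarith

theorem gradient_norm_lower_bound_of_not_epsOP
    (M N : ℕ) (hM : 0 < M) (ε : ℝ) (hε0 : 0 < ε) (hε1 : ε ≤ 1)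
    (F : Matrix (Fin M) (Fin N) ℂ)
    (hunit : ∀ n : Fin N, ‖col F n‖ = 1)
    (hclose : Real.sqrt
        (hsq (F * F.conjTranspose - ((N : ℂ) / M) • (1 : Matrix (Fin M) (Fin M) ℂ)))
      ≤ N / (2 * M))
    (hnop : ¬ epsOP F ε) :
    ε ^ 2 / (4 * (M : ℝ) ^ 4)
        * hsq (F * F.conjTranspose - ((N : ℂ) / M) • (1 : Matrix (Fin M) (Fin M) ℂ))
      ≤ ∑ n : Fin N,
          ‖frameOp F (col F n) - ⟪col F n, frameOp F (col F n)⟫_ℂ • col F n‖ ^ 2 := by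
  set A := F * F.conjTranspose - ((N : ℂ) / M) • (1 : Matrix (Fin M) (Fin M) ℂ) with hAdef
  have hM0 : (0 : ℝ) < M := by exact_mod_cast hM
  have hA : A.IsHermitian := by
    rw [Matrix.IsHermitian, hAdef]
    simp [Matrix.conjTranspose_sub, Matrix.conjTranspose_smul, Matrix.conjTranspose_mul]
  rw [hsq_eq_sum_eigenvalues_sq A hA] at hclose ⊢
  set x := hA.eigenvalues with hx
  set e := hA.eigenvectorBasis with he
  set p : Fin N → Fin M → ℝ := fun n i => ‖⟪e i, col F n⟫_ℂ‖ ^ 2 with hp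
  have hp0 : ∀ n i, 0 ≤ p n i := fun n i => by positivity
  have hp1 : ∀ n, ∑ i, p n i = 1 := fun n => by
    simp only [hp]
    rw [e.sum_sq_norm_inner_right, hunit, one_pow]
  have hframe (i : Fin M) : frameOp F (e i) = ((x i + N / M : ℝ) : ℂ) • e i := by
    have h : A.mulVec (e i) = x i • ⇑(e i) := hA.mulVec_eigenvectorBasis i
    rw [hAdef, Matrix.sub_mulVec, sub_eq_iff_eq_add] at h
    ext m
    simp [frameOp, h, Matrix.smul_mulVec, add_mul]
  have hinner (n : Fin N) (i : Fin M) :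
      ⟪e i, frameOp F (col F n)⟫_ℂ = ((x i + N / M : ℝ) : ℂ) * ⟪e i, col F n⟫_ℂ := by
    rw [inner_frameOp_right, hframe, inner_smul_left, Complex.conj_ofReal]
  have hcol (i : Fin M) : ∑ n, p n i = x i + N / M := by
    have h := inner_frameOp F (e i) (e i)
    rw [hframe, inner_smul_right, inner_self_eq_norm_sq_to_K, e.norm_eq_one] at h
    have h' (n : Fin N) : ⟪col F n, e i⟫_ℂ * ⟪e i, col F n⟫_ℂ = ((p n i : ℝ) : ℂ) := by
      rw [← inner_conj_symm, Complex.conj_mul']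
      simp [hp]
    simp_rw [h'] at h
    have h2 : ((x i + N / M : ℝ) : ℂ) = ((∑ n, p n i : ℝ) : ℂ) := by
      rw [Complex.ofReal_sum, ← h]
      simp
    exact (Complex.ofReal_injective h2).symm
  have hxsum : ∑ i, x i = 0 := by
    have h : ∑ i, (x i + N / M) = (N : ℝ) := by
      simp_rw [← hcol]
      rw [Finset.sum_comm]
      simp [hp1]
    rw [Finset.sum_add_distrib] at h
    simp only [sum_const, card_univ, Fintype.card_fin, nsmul_eq_mul] at h
    rw [mul_div_cancel₀ _ hM0.ne'] at h
    linarith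
  rcases (Finset.sum_nonneg fun i _ => sq_nonneg (x i) : 0 ≤ ∑ i, x i ^ 2).eq_or_lt with h0 | hpos
  · rw [← h0, mul_zero]
    positivity
  have hlam (i : Fin M) : (N : ℝ) / (2 * M) ≤ x i + N / M := by
    have h := Real.abs_le_sqrt
      (Finset.single_le_sum (f := fun i => x i ^ 2) (fun i _ => sq_nonneg (x i)) (mem_univ i))
    have h' := neg_le_of_abs_le (h.trans hclose)
    have : (N : ℝ) / M = 2 * (N / (2 * M)) := by field_simp
    linarith
  have hN : 0 < N := by
    rw [Nat.pos_iff_ne_zero]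
    rintro rfl
    have h := Real.sqrt_pos.2 hpos
    simp at hclose
    linarith
  obtain ⟨a, b, hab, hgap, hsep, ⟨i₀, hi₀⟩, ⟨i₁, hi₁⟩⟩ := exists_gap_of_sum_eq_zero x hxsum hpos
  rw [Fintype.card_fin] at hgap
  set q : Fin N → ℝ := fun n => ∑ i with b ≤ x i, p n i with hq
  have hterm (n : Fin N) : (b - a) ^ 2 * (q n * (1 - q n)) ≤
      ‖frameOp F (col F n) - ⟪col F n, frameOp F (col F n)⟫_ℂ • col F n‖ ^ 2 := by
    set μ := ⟪col F n, frameOp F (col F n)⟫_ℂ with hμ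
    refine (gap_sq_mul_le_sum_mul_sq (p n) x (hp0 n) (hp1 n) hab hsep (μ.re - N / M)).trans ?_
    rw [← e.sum_sq_norm_inner_right]
    refine Finset.sum_le_sum fun i _ => ?_
    rw [inner_sub_right, inner_smul_right, hinner, ← sub_mul, norm_mul, mul_pow, mul_comm]
    refine mul_le_mul_of_nonneg_right ?_ (hp0 n i)
    rw [← sq_abs]
    refine pow_le_pow_left₀ (abs_nonneg _) ?_ 2
    refine le_trans (le_of_eq ?_) (Complex.abs_re_le_norm _)
    rw [Complex.sub_re, Complex.ofReal_re]
    congr 1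
    ring
  have hcompl (n : Fin N) : 1 - q n = ∑ i with ¬ b ≤ x i, p n i := by
    rw [← hp1 n, ← Finset.sum_filter_add_sum_filter_not univ (fun i => b ≤ x i) (p n)]
    simp [hq]
  have hsub (n : Fin N) (s : Finset (Fin M)) (i : Fin M) (hi : i ∈ s) : p n i ≤ ∑ i ∈ s, p n i :=
    Finset.single_le_sum (fun i _ => hp0 n i) hi
  have hmain := sq_div_four_mul_le_sum_of_not_epsOP hM hN hε0 hε1 hnop q
    (fun n => Finset.sum_nonneg fun i _ => hp0 n i)
    (fun n => by
      have : 0 ≤ 1 - q n := by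
        rw [hcompl]
        exact Finset.sum_nonneg fun i _ => hp0 n i
      linarith)
    (fun i j => norm_inner_le_sqrt_add_sqrt e (fun k => b ≤ x k) _ _ (hunit i) (hunit j))
    ((hlam i₁).trans <| (hcol i₁).symm.trans_le <| Finset.sum_le_sum fun n _ =>
      hsub n _ i₁ (by simpa using hi₁))
    ((hlam i₀).trans <| (hcol i₀).symm.trans_le <| Finset.sum_le_sum fun n _ => by
      rw [hcompl]
      exact hsub n _ i₀ (by simpa using hi₀.trans_lt hab))
  calc ε ^ 2 / (4 * (M : ℝ) ^ 4) * ∑ i, x i ^ 2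
      ≤ ε ^ 2 / (4 * (M : ℝ) ^ 4) * ((M : ℝ) ^ 3 * (b - a) ^ 2) := by gcongr
    _ = (b - a) ^ 2 * (ε ^ 2 / (4 * M)) := by field_simp
    _ ≤ (b - a) ^ 2 * ∑ n, q n * (1 - q n) := by gcongr
    _ ≤ _ := by
      rw [Finset.mul_sum]
      exact Finset.sum_le_sum fun n _ => hterm n
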